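/- Let α ∈ {1, −1}, where e_{−1} = e_{n−1}, he_{−1} = he_{n−1}, and −α denotes the other element of {1, −1}. Then for all x₁, x₂, x₃ ∈ sl₂(ℂ): (a) f(x₁) · x₂ · g(x₃) = f(x₃) · x₂ · g(x₁) for all f, g ∈ {e_α, he_α}; (b) e_α(x₁) · x₂ · he_{−α}(x₃) = he_{−α}(x₃) · x₂ · e_α(x₁). -/

import Mathlib

open scoped BigOperators

/-- The algebra of `2 × 2` complex matrices. -/
abbrev M2 : Type := Matrix (Fin 2) (Fin 2) ℂ

/-- The diagonal matrix `D = diag(1, ω)`. -/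
noncomputable def Dmat (ω : ℂ) : M2 := Matrix.diagonal ![1, ω]

/-- The linear map `e_i : M₂(ℂ) → M₂(ℂ)`, `e_i(x) = (1/n) ∑_{j=0}^{n-1} ω^{-i j} D^j x D^{-j}`. -/
noncomputable def eM (n : ℕ) (ω : ℂ) (i : ℕ) (x : M2) : M2 :=
  (n : ℂ)⁻¹ • ∑ j ∈ Finset.range n, (ω ^ (i * j))⁻¹ • (Dmat ω ^ j * x * (Dmat ω ^ j)⁻¹)

/-- The matrix `H = e₁₂ + e₂₁`. -/
noncomputable def Hmat : M2 := !![0, 1; 1, 0]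

/-- The map `he_i(x) = H ⬝ e_i(x) ⬝ H`. -/
noncomputable def hem (n : ℕ) (ω : ℂ) (i : ℕ) (x : M2) : M2 := Hmat * eM n ω i x * Hmat

theorem Dmat_pow (ω : ℂ) (j : ℕ) : Dmat ω ^ j = Matrix.diagonal ![1, ω ^ j] := by
  rw [Dmat, Matrix.diagonal_pow]
  congr 1
  ext a
  fin_cases a <;> simp

theorem inv_Dmat_pow {ω : ℂ} (hω : ω ≠ 0) (j : ℕ) :
    (Dmat ω ^ j)⁻¹ = Matrix.diagonal ![1, (ω ^ j)⁻¹] := by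
  apply Matrix.inv_eq_right_inv
  rw [Dmat_pow, Matrix.diagonal_mul_diagonal, ← Matrix.diagonal_one]
  congr 1
  ext a
  fin_cases a <;> simp [hω]

/-- `e_i` multiplies each matrix entry by an average of powers of a root of unity. -/
theorem eM_apply {ω : ℂ} (hω : ω ≠ 0) (n i : ℕ) (x : M2) (a b : Fin 2) :
    eM n ω i x a b = (n : ℂ)⁻¹ *
      (∑ j ∈ Finset.range n, ((ω ^ i)⁻¹ * ![1, ω] a * (![1, ω] b)⁻¹) ^ j) * x a b := by
  simp only [eM, Matrix.smul_apply, Matrix.sum_apply, smul_eq_mul, inv_Dmat_pow hω]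
  rw [mul_assoc, Finset.sum_mul]
  congr 1
  refine Finset.sum_congr rfl fun j _ => ?_
  rw [Dmat_pow, Matrix.mul_diagonal, Matrix.diagonal_mul, pow_mul]
  fin_cases a <;> fin_cases b <;> simp [mul_pow] <;> ring

theorem inv_mul_geom_sum_of_pow_eq_one {n : ℕ} (hn : n ≠ 0) {z : ℂ} (hz : z ^ n = 1) :
    (n : ℂ)⁻¹ * ∑ j ∈ Finset.range n, z ^ j = if z = 1 then 1 else 0 := by
  split_ifs with h
  · simp [h, hn]
  · rw [geom_sum_eq h, hz]
    simp

theorem eM_one {n : ℕ} (hn : 3 ≤ n) {ω : ℂ} (hω : IsPrimitiveRoot ω n) (x : M2) :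
    eM n ω 1 x = !![0, 0; x 1 0, 0] := by
  have hn0 : n ≠ 0 := by omega
  have h0 : ω ≠ 0 := hω.ne_zero hn0
  have h1 : ω ≠ 1 := hω.ne_one (by omega)
  have h2 : ω⁻¹ * ω⁻¹ ≠ 1 := by
    rw [← mul_inv, ← pow_two, inv_ne_one]
    exact hω.pow_ne_one_of_pos_of_lt (by norm_num) (by omega)
  ext a b
  rw [eM_apply h0, inv_mul_geom_sum_of_pow_eq_one hn0]
  · fin_cases a <;> fin_cases b <;> simp [h1, h2, inv_mul_cancel₀ h0]
  · fin_cases a <;> fin_cases b <;> simp [mul_pow, hω.pow_eq_one, h0]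

theorem eM_sub_one {n : ℕ} (hn : 3 ≤ n) {ω : ℂ} (hω : IsPrimitiveRoot ω n) (x : M2) :
    eM n ω (n - 1) x = !![0, x 0 1; 0, 0] := by
  have hn0 : n ≠ 0 := by omega
  have h0 : ω ≠ 0 := hω.ne_zero hn0
  have h1 : ω ≠ 1 := hω.ne_one (by omega)
  have h2 : ω * ω ≠ 1 := by
    rw [← pow_two]
    exact hω.pow_ne_one_of_pos_of_lt (by norm_num) (by omega)
  have hinv : (ω ^ (n - 1))⁻¹ = ω := by
    refine inv_eq_of_mul_eq_one_right ?_
    rw [pow_sub_one_mul hn0, hω.pow_eq_one]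
  ext a b
  rw [eM_apply h0, hinv, inv_mul_geom_sum_of_pow_eq_one hn0]
  · fin_cases a <;> fin_cases b <;> simp [h0, h1, h2]
  · fin_cases a <;> fin_cases b <;> simp [mul_pow, hω.pow_eq_one, h0]

theorem hem_one {n : ℕ} (hn : 3 ≤ n) {ω : ℂ} (hω : IsPrimitiveRoot ω n) (x : M2) :
    hem n ω 1 x = !![0, x 1 0; 0, 0] := by
  rw [hem, Hmat, eM_one hn hω, Matrix.mul_fin_two, Matrix.mul_fin_two]
  simp

theorem hem_sub_one {n : ℕ} (hn : 3 ≤ n) {ω : ℂ} (hω : IsPrimitiveRoot ω n) (x : M2) :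
    hem n ω (n - 1) x = !![0, 0; x 0 1, 0] := by
  rw [hem, Hmat, eM_sub_one hn hω, Matrix.mul_fin_two, Matrix.mul_fin_two]
  simp

/-- Let `α ∈ {1, -1}` (with `e_{-1} = e_{n-1}`, `he_{-1} = he_{n-1}`, and `-α` (denoted `β`) the
other element of `{1, -1}`). Then for all `x₁, x₂, x₃ ∈ sl₂(ℂ)`:
(a) `f(x₁) x₂ g(x₃) = f(x₃) x₂ g(x₁)` for all `f, g ∈ {e_α, he_α}`;
(b) `e_α(x₁) x₂ he_{-α}(x₃) = he_{-α}(x₃) x₂ e_α(x₁)`. -/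
theorem sandwich_identities (n : ℕ) (hn : 3 ≤ n) (ω : ℂ) (hω : IsPrimitiveRoot ω n)
    (α β : ℕ) (hαβ : (α = 1 ∧ β = n - 1) ∨ (α = n - 1 ∧ β = 1))
    (x₁ x₂ x₃ : M2) (hx₁ : Matrix.trace x₁ = 0) (hx₂ : Matrix.trace x₂ = 0)
    (hx₃ : Matrix.trace x₃ = 0) :
    (∀ f g : M2 → M2, f = eM n ω α ∨ f = hem n ω α → g = eM n ω α ∨ g = hem n ω α →
      f x₁ * x₂ * g x₃ = f x₃ * x₂ * g x₁) ∧
    eM n ω α x₁ * x₂ * hem n ω β x₃ = hem n ω β x₃ * x₂ * eM n ω α x₁ := by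
  rw [Matrix.eta_fin_two x₂]
  rcases hαβ with ⟨rfl, rfl⟩ | ⟨rfl, rfl⟩
  · refine ⟨?_, ?_⟩
    · rintro f g (rfl | rfl) (rfl | rfl) <;>
        simp only [eM_one hn hω, hem_one hn hω, Matrix.mul_fin_two] <;> ring_nf
    · simp only [eM_one hn hω, hem_sub_one hn hω, Matrix.mul_fin_two]
      ring_nf
  · refine ⟨?_, ?_⟩
    · rintro f g (rfl | rfl) (rfl | rfl) <;>
        simp only [eM_sub_one hn hω, hem_sub_one hn hω, Matrix.mul_fin_two] <;> ring_nf
    · simp only [eM_sub_one hn hω, hem_one hn hω, Matrix.mul_fin_two]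
      ring_nf
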